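/- Let (a,x) be a signal with d nodes forming an (i,h,M)-cluster, and assume in addition that x_i − x_{i−1} ≥ 3h if i > 1 and x_{i+2} − x_{i+1} ≥ 3h if i+1 < d. Let κ = (x_i + x_{i+1})/2, N ≥ 2d, and C = 18·M·(1+|κ|)^N. Then for every ε ≥ C·h³ there exists a signal (a',x') with x'_1 < … < x'_d such that |m_k(a',x') − m_k(a,x)| ≤ ε for all k = 0, 1, …, N−1, and the Euclidean distance between the node vectors satisfies ‖x' − x‖ ≥ h/2. In particular, the worst-case node reconstruction error ρ^x_ε(a,x) = sup over (a',x') in the ε-error set of ‖x' − x‖ is at least h/2. -/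

import Mathlib

open Finset

lemma local_half (p q : ℝ) (hpq : |q| ≤ |p|) :
    ∃ b1 b2 y1 : ℝ, -1 ≤ y1 ∧ y1 < 1 ∧ b1 + b2 = p + q ∧
      b1 * y1 + b2 = -p / 2 + q / 2 ∧ b1 * y1 ^ 2 + b2 = p / 4 + q / 4 ∧
      |b1| ≤ 2 * |p| ∧ |b2| ≤ 2 * |p| := by
  by_cases hp : p = 0
  · subst hp
    have hq : q = 0 := by simpa using hpq
    subst hq
    exact ⟨0, 0, 0, by norm_num, by norm_num, by simp, by simp, by simp, by simp, by simp⟩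
  · obtain ⟨r, rfl⟩ : ∃ r, q = r * p := ⟨q / p, by field_simp⟩
    have hr : |r| ≤ 1 := by
      rw [abs_mul] at hpq
      have : 0 < |p| := abs_pos.mpr hp
      by_contra hc
      push Not at hc
      nlinarith
    obtain ⟨h1, h2⟩ := abs_le.mp hr
    have h3 : 0 < r + 3 := by linarith
    have h9 : 0 < r + 9 := by linarith
    refine ⟨(r + 3) ^ 2 / (r + 9) * p, 4 * r / (r + 9) * p, (r - 3) / (2 * (r + 3)),
      ?_, ?_, ?_, ?_, ?_, ?_, ?_⟩
    · rw [le_div_iff₀ (by positivity)]; linarith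
    · rw [div_lt_iff₀ (by positivity)]; linarith
    · field_simp; ring
    · field_simp; ring
    · field_simp; ring
    · rw [abs_mul]
      gcongr
      rw [abs_le, le_div_iff₀ h9, div_le_iff₀ h9]
      constructor <;> nlinarith
    · rw [abs_mul]
      gcongr
      rw [abs_le, le_div_iff₀ h9, div_le_iff₀ h9]
      constructor <;> nlinarith

lemma local_full (p q M : ℝ) (hp : |p| ≤ M) (hq : |q| ≤ M) :
    ∃ b1 b2 y1 y2 : ℝ, |y1| ≤ 1 ∧ |y2| ≤ 1 ∧ y1 < y2 ∧ b1 + b2 = p + q ∧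
      b1 * y1 + b2 * y2 = p * (-1 / 2) + q * (1 / 2) ∧
      b1 * y1 ^ 2 + b2 * y2 ^ 2 = p * (-1 / 2) ^ 2 + q * (1 / 2) ^ 2 ∧
      |b1| ≤ 2 * M ∧ |b2| ≤ 2 * M ∧ 1 / 4 ≤ (y1 + 1 / 2) ^ 2 + (y2 - 1 / 2) ^ 2 := by
  rcases le_total |q| |p| with hc | hc
  · obtain ⟨b1, b2, y, h1, h2, h3, h4, h5, h6, h7⟩ := local_half p q hc
    refine ⟨b1, b2, y, 1, abs_le.mpr ⟨h1, h2.le⟩, by simp, h2, h3, by linarith, by linarith,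
      by linarith, by linarith, by nlinarith [sq_nonneg (y + 1 / 2)]⟩
  · obtain ⟨b1, b2, y, h1, h2, h3, h4, h5, h6, h7⟩ := local_half q p hc
    refine ⟨b2, b1, -1, -y, by simp, abs_le.mpr ⟨by linarith, by linarith⟩, by linarith,
      by linarith, by linarith, by linarith,
      by linarith, by linarith, by nlinarith [sq_nonneg (-y - 1 / 2)]⟩

lemma term_bound (b y h B : ℝ) (k : ℕ) (hh0 : 0 < h) (hh1 : h < 1) (hb : |b| ≤ B)
    (hy : |y| ≤ 1) (hk : 3 ≤ k) : |b * (h * y) ^ k| ≤ B * h ^ 3 := by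
  have hB : 0 ≤ B := (abs_nonneg b).trans hb
  rw [abs_mul, abs_pow, abs_mul, abs_of_pos hh0, mul_pow]
  have e1 : h ^ k ≤ h ^ 3 := pow_le_pow_of_le_one hh0.le hh1.le hk
  have e2 : |y| ^ k ≤ 1 := pow_le_one₀ (abs_nonneg y) hy
  have e3 : h ^ k * |y| ^ k ≤ h ^ 3 * 1 := by gcongr
  calc |b| * (h ^ k * |y| ^ k) ≤ B * (h ^ 3 * 1) := by gcongr
    _ = B * h ^ 3 := by ring

lemma shift_bound (κ b1 b2 p q z1 z2 w1 w2 E : ℝ)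
    (hD : ∀ k : ℕ, |b1 * z1 ^ k + b2 * z2 ^ k - p * w1 ^ k - q * w2 ^ k| ≤ E) (k : ℕ) :
    |b1 * (z1 + κ) ^ k + b2 * (z2 + κ) ^ k - p * (w1 + κ) ^ k - q * (w2 + κ) ^ k|
      ≤ E * (1 + |κ|) ^ k := by
  have e : b1 * (z1 + κ) ^ k + b2 * (z2 + κ) ^ k - p * (w1 + κ) ^ k - q * (w2 + κ) ^ k
      = ∑ m ∈ range (k + 1), (b1 * z1 ^ m + b2 * z2 ^ m - p * w1 ^ m - q * w2 ^ m) *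
        (κ ^ (k - m) * (k.choose m : ℝ)) := by
    simp only [add_pow, mul_sum]
    rw [← sum_add_distrib, ← sum_sub_distrib, ← sum_sub_distrib]
    exact sum_congr rfl fun m _ => by ring
  rw [e, add_pow, mul_sum]
  refine (abs_sum_le_sum_abs _ _).trans (sum_le_sum fun m _ => ?_)
  rw [abs_mul, abs_mul, abs_pow, Nat.abs_cast, one_pow, one_mul]
  exact mul_le_mul_of_nonneg_right (hD m) (by positivity)

/-- For a `d`-node signal `(a,x)` forming an `(i,h,M)`-cluster, whose
neighboring nodes are at distance `≥ 3h` from the cluster, with `κ = (x_i+x_{i+1})/2`,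
`N ≥ 2d`, `C = 18·M·(1+|κ|)^N`, and for every `ε ≥ C·h³`, there is a signal `(a',x')`
in the `ε`-error set `E_ε(a,x)` whose node vector is at Euclidean distance `≥ h/2`
from `x`; hence the worst-case node reconstruction error is at least `h/2`. -/
theorem worst_case_node_error_lower_bound
    (d N : ℕ) (a x : ℕ → ℝ) (i : ℕ) (h M ε : ℝ)
    (hid : i + 1 < d)
    (hord : ∀ j, j + 1 < d → x j < x (j + 1))
    (hh0 : 0 < h) (hh1 : h < 1) (hM : 0 < M)
    (hcl : x (i + 1) - x i = h)
    (hai : |a i| ≤ M) (hai1 : |a (i + 1)| ≤ M)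
    (hleft : 1 ≤ i → x i - x (i - 1) ≥ 3 * h)
    (hright : i + 2 < d → x (i + 2) - x (i + 1) ≥ 3 * h)
    (hN : 2 * d ≤ N)
    (hε : 18 * M * (1 + |(x i + x (i + 1)) / 2|) ^ N * h ^ 3 ≤ ε) :
    ∃ a' x' : ℕ → ℝ,
      (∀ j, j + 1 < d → x' j < x' (j + 1)) ∧
      (∀ k < N, |∑ j ∈ range d, a' j * x' j ^ k - ∑ j ∈ range d, a j * x j ^ k| ≤ ε) ∧
      Real.sqrt (∑ j ∈ range d, (x' j - x j) ^ 2) ≥ h / 2 := by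
  obtain ⟨b1, b2, y1, y2, hy1, hy2, hlt, m0, m1, m2, hb1, hb2, hdist⟩ :=
    local_full (a i) (a (i + 1)) M hai hai1
  set κ := (x i + x (i + 1)) / 2 with hκ
  have hxi : x i = h * (-1 / 2) + κ := by rw [hκ]; linarith
  have hxi1 : x (i + 1) = h * (1 / 2) + κ := by rw [hκ]; linarith
  have hD : ∀ k : ℕ, |b1 * (h * y1) ^ k + b2 * (h * y2) ^ k - a i * (h * (-1 / 2)) ^ k
      - a (i + 1) * (h * (1 / 2)) ^ k| ≤ 18 * M * h ^ 3 := by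
    intro k
    have hpos : 0 < M * h ^ 3 := by positivity
    rcases Nat.lt_or_ge k 3 with hk | hk
    · have : b1 * (h * y1) ^ k + b2 * (h * y2) ^ k - a i * (h * (-1 / 2)) ^ k
          - a (i + 1) * (h * (1 / 2)) ^ k = 0 := by
        interval_cases k
        · simp only [pow_zero]; linear_combination m0
        · linear_combination h * m1
        · linear_combination h ^ 2 * m2
      rw [this, abs_zero]; linarith
    · have t1 := abs_le.mp (term_bound b1 y1 h (2 * M) k hh0 hh1 hb1 hy1 hk)
      have t2 := abs_le.mp (term_bound b2 y2 h (2 * M) k hh0 hh1 hb2 hy2 hk)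
      have t3 := abs_le.mp (term_bound (a i) (-1 / 2) h M k hh0 hh1 hai
        (by rw [abs_le]; norm_num) hk)
      have t4 := abs_le.mp (term_bound (a (i + 1)) (1 / 2) h M k hh0 hh1 hai1
        (by rw [abs_le]; norm_num) hk)
      rw [abs_le]
      constructor <;> linarith [t1.1, t1.2, t2.1, t2.2, t3.1, t3.2, t4.1, t4.2]
  have hS := shift_bound κ _ _ _ _ _ _ _ _ _ hD
  obtain ⟨hy1l, hy1u⟩ := abs_le.mp hy1
  obtain ⟨hy2l, hy2u⟩ := abs_le.mp hy2
  have key : ∀ f : ℕ → ℝ, (∀ j, j ≠ i → j ≠ i + 1 → f j = 0) →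
      ∑ j ∈ range d, f j = f i + f (i + 1) := by
    intro f hf
    refine sum_eq_add_of_mem i (i + 1) (mem_range.mpr (by omega)) (mem_range.mpr hid)
      (by omega) fun c _ hc => hf c hc.1 hc.2
  refine ⟨fun j => if j = i then b1 else if j = i + 1 then b2 else a j,
    fun j => if j = i then h * y1 + κ else if j = i + 1 then h * y2 + κ else x j, ?_, ?_, ?_⟩
  · intro j hj
    have hjo := hord j hj
    by_cases c1 : j = i
    · subst c1
      simp
      nlinarith
    by_cases c2 : j = i + 1
    · subst c2
      have := hright hj
      have c4 : ¬ (i + 1 + 1 = i) := by omega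
      simp [c4]
      nlinarith
    by_cases c3 : j + 1 = i
    · subst c3
      have := hleft (by omega)
      simp [c2] at this ⊢
      nlinarith
    · simp [c1, c2, c3]
      exact hjo
  · intro k hk
    rw [← sum_sub_distrib, key]
    · simp only [if_true, Nat.succ_ne_self, if_false]
      rw [hxi, hxi1]
      refine le_trans (le_of_eq ?_) ((hS k).trans ?_)
      · congr 1; ring
      · refine le_trans ?_ hε
        have : (1 + |κ|) ^ k ≤ (1 + |κ|) ^ N :=
          pow_le_pow_right₀ (by linarith [abs_nonneg κ]) hk.le
        calc 18 * M * h ^ 3 * (1 + |κ|) ^ k ≤ 18 * M * h ^ 3 * (1 + |κ|) ^ N := by gcongr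
          _ = _ := by ring
    · intro j h1 h2
      simp [h1, h2]
  · rw [key]
    · simp only [if_true, Nat.succ_ne_self, if_false]
      rw [hxi, hxi1]
      apply Real.le_sqrt_of_sq_le
      have := mul_le_mul_of_nonneg_left hdist (sq_nonneg h)
      linarith
    · intro j h1 h2
      simp [h1, h2]
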